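/- Let ν̃(s,t) = (s⁵, s⁴t, s³t², s²t³, st⁴, t⁵) and let Γ ⊂ ℙ⁵ be the degree-5 rational normal curve {[ν̃(s,t)]}. Let F ∈ ℂ[X₀,…,X₅] be a nonzero homogeneous cubic all of whose first partial derivatives vanish at ν̃(s,t) for all (s,t) ∈ ℂ² (so Y = V(F) is a cubic hypersurface singular at every point of Γ). Then Y is swept out by planes: for every point y ∈ Y there exists a 3-dimensional linear subspace W ⊂ ℂ⁶ with F vanishing identically on W and y ∈ ℙ(W); in particular Y contains planes. -/

import Mathlib

/- STATEMENT 14: a cubic hypersurface Y = V(F) ⊂ ℙ⁵ singular at every point of the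
degree-5 rational normal curve is swept out by planes; in particular it contains
planes. -/

open MvPolynomial

/-- Parametrization of the affine cone over the degree-5 rational normal curve. -/
noncomputable def nu5 (s t : ℂ) : Fin 6 → ℂ := ![s^5, s^4*t, s^3*t^2, s^2*t^3, s*t^4, t^5]

theorem MvPolynomial.pderiv_pderiv_comm {R σ : Type*} [CommRing R] (i j : σ)
    (p : MvPolynomial σ R) : pderiv i (pderiv j p) = pderiv j (pderiv i p) := by
  classical
  have h : ⁅(pderiv i : Derivation R (MvPolynomial σ R) (MvPolynomial σ R)),
      (pderiv j : Derivation R (MvPolynomial σ R) (MvPolynomial σ R))⁆ = 0 := by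
    ext k : 1
    rw [Derivation.commutator_apply]
    simp [pderiv_X, Pi.single_apply, apply_ite]
  have := congrArg (fun D => D p) h
  rwa [Derivation.commutator_apply, Derivation.zero_apply, sub_eq_zero] at this

/-- The coefficients of the symmetric trilinear form polarizing a cubic form. -/
noncomputable def cubicPolar {σ : Type*} (F : MvPolynomial σ ℂ) (i j k : σ) : ℂ :=
  coeff 0 (pderiv k (pderiv j (pderiv i F)))

theorem cubicPolar_swap_left {σ : Type*} (F : MvPolynomial σ ℂ) (i j k : σ) :
    cubicPolar F i j k = cubicPolar F j i k := by
  rw [cubicPolar, pderiv_pderiv_comm j i, cubicPolar]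

theorem cubicPolar_swap_right {σ : Type*} (F : MvPolynomial σ ℂ) (i j k : σ) :
    cubicPolar F i j k = cubicPolar F i k j := by
  rw [cubicPolar, pderiv_pderiv_comm k j, cubicPolar]

theorem MvPolynomial.IsHomogeneous.sum_mul_eval_pderiv {σ : Type*} [Fintype σ]
    {F : MvPolynomial σ ℂ} {n : ℕ} (hF : F.IsHomogeneous n) (x : σ → ℂ) :
    ∑ i, x i * eval x (pderiv i F) = n * eval x F := by
  simpa using congrArg (eval x) hF.sum_X_mul_pderiv

theorem two_mul_eval_pderiv {σ : Type*} [Fintype σ] {F : MvPolynomial σ ℂ}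
    (hF : F.IsHomogeneous 3) (x : σ → ℂ) (i : σ) :
    2 * eval x (pderiv i F) = ∑ j, ∑ k, cubicPolar F i j k * (x j * x k) := by
  have h1 : (pderiv i F).IsHomogeneous 2 := hF.pderiv
  have h2 (j : σ) : (pderiv j (pderiv i F)).IsHomogeneous 1 := h1.pderiv
  have h3 (j k : σ) : eval x (pderiv k (pderiv j (pderiv i F))) = cubicPolar F i j k := by
    have h0 : (pderiv k (pderiv j (pderiv i F))).IsHomogeneous 0 := (h2 j).pderiv
    rw [totalDegree_eq_zero_iff_eq_C.mp ((totalDegree_zero_iff_isHomogeneous _).mpr h0), eval_C,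
      cubicPolar]
  have h4 := h1.sum_mul_eval_pderiv x
  push_cast at h4
  rw [← h4]
  refine Finset.sum_congr rfl fun j _ => ?_
  have h5 := (h2 j).sum_mul_eval_pderiv x
  simp only [h3, Nat.cast_one, one_mul] at h5
  rw [← h5, Finset.mul_sum]
  exact Finset.sum_congr rfl fun k _ => by ring

theorem six_mul_eval {σ : Type*} [Fintype σ] {F : MvPolynomial σ ℂ}
    (hF : F.IsHomogeneous 3) (x : σ → ℂ) :
    6 * eval x F = ∑ i, ∑ j, ∑ k, cubicPolar F i j k * (x i * x j * x k) := by
  have h := hF.sum_mul_eval_pderiv x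
  push_cast at h
  rw [show (6 : ℂ) * eval x F = 2 * (3 * eval x F) by ring, ← h, Finset.mul_sum]
  refine Finset.sum_congr rfl fun i _ => ?_
  rw [mul_left_comm, two_mul_eval_pderiv hF, Finset.mul_sum]
  refine Finset.sum_congr rfl fun j _ => ?_
  rw [Finset.mul_sum]
  exact Finset.sum_congr rfl fun k _ => by ring

theorem nu5_one_apply (t : ℂ) (j : Fin 6) : nu5 1 t j = t ^ (j : ℕ) := by
  fin_cases j <;> simp [nu5]

theorem sum_antidiagonal_eq_zero {n : ℕ} (c : Fin n → Fin n → ℂ)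
    (h : ∀ t : ℂ, ∑ j, ∑ k, c j k * (t ^ (j : ℕ) * t ^ (k : ℕ)) = 0) (m : ℕ) :
    ∑ j : Fin n, ∑ k : Fin n, (if m = (j : ℕ) + k then c j k else 0) = 0 := by
  have hp : (∑ j, ∑ k, Polynomial.C (c j k) * Polynomial.X ^ ((j : ℕ) + k) : Polynomial ℂ) = 0 :=
    Polynomial.funext fun t => by simpa [Polynomial.eval_finsetSum, pow_add] using h t
  simpa [Polynomial.finsetSum_coeff, Polynomial.coeff_X_pow] using
    congrArg (Polynomial.coeff · m) hp

/-- The `3 × 4` catalecticant (Hankel) matrix of `x`, bordered below by the row `a`. -/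
def borderedHankel (a : Fin 4 → ℂ) (x : Fin 6 → ℂ) : Matrix (Fin 4) (Fin 4) ℂ :=
  !![x 0, x 1, x 2, x 3; x 1, x 2, x 3, x 4; x 2, x 3, x 4, x 5; a 0, a 1, a 2, a 3]

theorem cubic_sum_eq_det_borderedHankel (c : Fin 6 → Fin 6 → Fin 6 → ℂ)
    (hl : ∀ i j k, c i j k = c j i k) (hr : ∀ i j k, c i j k = c i k j)
    (h : ∀ l (m : ℕ), ∑ j : Fin 6, ∑ k : Fin 6, (if m = (j : ℕ) + k then c l j k else 0) = 0)
    (x : Fin 6 → ℂ) :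
    ∑ i, ∑ j, ∑ k, c i j k * (x i * x j * x k) =
      (borderedHankel ![c 3 3 3, -3 * c 2 3 3, 3 * c 2 2 3, -c 2 2 2] x).det := by
  have key (l : Fin 6) (m : Fin 11) := h l m
  clear h
  simp only [Fin.sum_univ_six, Fin.forall_fin_succ] at key ⊢
  simp [borderedHankel, Matrix.det_succ_row_zero, Fin.sum_univ_succ, Fin.succAbove,
    hl 1 0, hr _ 1 0, hl 2 0, hr _ 2 0, hl 2 1, hr _ 2 1, hl 3 0, hr _ 3 0, hl 3 1, hr _ 3 1,
    hl 3 2, hr _ 3 2, hl 4 0, hr _ 4 0, hl 4 1, hr _ 4 1, hl 4 2, hr _ 4 2, hl 4 3, hr _ 4 3,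
    hl 5 0, hr _ 5 0, hl 5 1, hr _ 5 1, hl 5 2, hr _ 5 2, hl 5 3, hr _ 5 3, hl 5 4, hr _ 5 4] at key ⊢
  clear hl hr
  grind

theorem finrank_comap_span_singleton {K V V' : Type*} [Field K] [AddCommGroup V] [Module K V]
    [AddCommGroup V'] [Module K V'] [FiniteDimensional K V] [FiniteDimensional K V']
    {L : V →ₗ[K] V'} (hL : Function.Surjective L) {a : V'} (ha : a ≠ 0) :
    Module.finrank K ((K ∙ a).comap L) + Module.finrank K V' = Module.finrank K V + 1 := by
  have h1 := ((K ∙ a).mkQ ∘ₗ L).finrank_range_add_finrank_ker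
  have hs : Function.Surjective ((K ∙ a).mkQ ∘ₗ L) := (Submodule.mkQ_surjective _).comp hL
  rw [LinearMap.range_eq_top.mpr hs, finrank_top,
    LinearMap.ker_comp, Submodule.ker_mkQ] at h1
  have h2 := (K ∙ a).finrank_quotient_add_finrank
  rw [finrank_span_singleton ha] at h2
  omega

/-- Contraction of `x`, seen as a form on binary quintics, with the binary quadric `q`. -/
def contraction (q : Fin 3 → ℂ) : (Fin 6 → ℂ) →ₗ[ℂ] (Fin 4 → ℂ) :=
  Matrix.mulVecLin
    !![q 0, q 1, q 2, 0, 0, 0; 0, q 0, q 1, q 2, 0, 0; 0, 0, q 0, q 1, q 2, 0;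
      0, 0, 0, q 0, q 1, q 2]

theorem contraction_apply (q : Fin 3 → ℂ) (x : Fin 6 → ℂ) :
    contraction q x = ![q 0 * x 0 + q 1 * x 1 + q 2 * x 2, q 0 * x 1 + q 1 * x 2 + q 2 * x 3,
      q 0 * x 2 + q 1 * x 3 + q 2 * x 4, q 0 * x 3 + q 1 * x 4 + q 2 * x 5] := by
  ext k
  fin_cases k <;> simp [contraction, Matrix.mulVec, dotProduct, Fin.sum_univ_six]

theorem contraction_surjective {q : Fin 3 → ℂ} (hq : q ≠ 0) :
    Function.Surjective (contraction q) := by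
  intro b
  by_cases h0 : q 0 = 0
  · by_cases h1 : q 1 = 0
    · have h2 : q 2 ≠ 0 := fun h2 => hq (by ext r; fin_cases r <;> assumption)
      refine ⟨![0, 0, b 0 / q 2, b 1 / q 2, b 2 / q 2, b 3 / q 2], ?_⟩
      ext k
      fin_cases k <;> simp [contraction_apply, h0, h1] <;> field_simp
    · let x4 := b 3 / q 1
      let x3 := (b 2 - q 2 * x4) / q 1
      let x2 := (b 1 - q 2 * x3) / q 1
      let x1 := (b 0 - q 2 * x2) / q 1
      refine ⟨![0, x1, x2, x3, x4, 0], ?_⟩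
      ext k
      fin_cases k <;> simp [contraction_apply, h0, x1, x2, x3, x4] <;> field_simp <;> ring
  · let x3 := b 3 / q 0
    let x2 := (b 2 - q 1 * x3) / q 0
    let x1 := (b 1 - q 1 * x2 - q 2 * x3) / q 0
    let x0 := (b 0 - q 1 * x1 - q 2 * x2) / q 0
    refine ⟨![x0, x1, x2, x3, 0, 0], ?_⟩
    ext k
    fin_cases k <;> simp [contraction_apply, x0, x1, x2, x3] <;> field_simp <;> ring

theorem vecMul_borderedHankel (a : Fin 4 → ℂ) (x : Fin 6 → ℂ) (q : Fin 3 → ℂ) (c : ℂ) :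
    Matrix.vecMul ![q 0, q 1, q 2, c] (borderedHankel a x) = contraction q x + c • a := by
  ext k
  fin_cases k <;>
    simp [contraction_apply, borderedHankel, Matrix.vecMul, dotProduct, Fin.sum_univ_four]

theorem det_borderedHankel_eq_zero_iff {a : Fin 4 → ℂ} (ha : a ≠ 0) (x : Fin 6 → ℂ) :
    (borderedHankel a x).det = 0 ↔ ∃ q ≠ 0, contraction q x ∈ ℂ ∙ a := by
  rw [← Matrix.exists_vecMul_eq_zero_iff]
  constructor
  · rintro ⟨v, hv, h⟩
    have hv' : v = ![(![v 0, v 1, v 2] : Fin 3 → ℂ) 0, (![v 0, v 1, v 2] : Fin 3 → ℂ) 1,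
        (![v 0, v 1, v 2] : Fin 3 → ℂ) 2, v 3] := by
      ext k; fin_cases k <;> rfl
    rw [hv', vecMul_borderedHankel] at h
    refine ⟨![v 0, v 1, v 2], fun hq => hv ?_, ?_⟩
    · rw [hq, contraction_apply] at h
      have h3 : v 3 = 0 := by
        refine (smul_eq_zero.mp (?_ : v 3 • a = 0)).resolve_right ha
        rw [← h]
        ext k; fin_cases k <;> simp
      rw [hv', hq, h3]
      ext k; fin_cases k <;> rfl
    · exact Submodule.mem_span_singleton.mpr ⟨-v 3, by rw [neg_smul, eq_neg_of_add_eq_zero_left h]⟩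
  · rintro ⟨q, hq, h⟩
    obtain ⟨c, hc⟩ := Submodule.mem_span_singleton.mp h
    refine ⟨![q 0, q 1, q 2, -c], fun h0 => hq ?_, ?_⟩
    · ext r
      fin_cases r
      · exact congrFun h0 0
      · exact congrFun h0 1
      · exact congrFun h0 2
    · rw [vecMul_borderedHankel, ← hc, neg_smul, add_neg_cancel]

theorem exists_finrank_three_of_det_borderedHankel_eq_zero {a : Fin 4 → ℂ} (ha : a ≠ 0)
    {y : Fin 6 → ℂ} (hy : (borderedHankel a y).det = 0) :
    ∃ W : Submodule ℂ (Fin 6 → ℂ), Module.finrank ℂ W = 3 ∧ y ∈ W ∧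
      ∀ w ∈ W, (borderedHankel a w).det = 0 := by
  obtain ⟨q, hq, h⟩ := (det_borderedHankel_eq_zero_iff ha y).mp hy
  refine ⟨(ℂ ∙ a).comap (contraction q), ?_, h,
    fun w hw => (det_borderedHankel_eq_zero_iff ha w).mpr ⟨q, hq, hw⟩⟩
  have := finrank_comap_span_singleton (contraction_surjective hq) ha
  simp only [Module.finrank_fin_fun] at this
  omega

theorem exists_six_mul_eval_eq_det_borderedHankel {F : MvPolynomial (Fin 6) ℂ}
    (hF : F.IsHomogeneous 3)
    (hsing : ∀ (s t : ℂ) (i : Fin 6), eval (nu5 s t) (pderiv i F) = 0) :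
    ∃ a, ∀ x, 6 * eval x F = (borderedHankel a x).det := by
  refine ⟨_, fun x => (six_mul_eval hF x).trans <| cubic_sum_eq_det_borderedHankel (cubicPolar F)
    (cubicPolar_swap_left F) (cubicPolar_swap_right F)
    (fun l => sum_antidiagonal_eq_zero _ fun t => ?_) x⟩
  simpa [hsing, nu5_one_apply] using (two_mul_eval_pderiv hF (nu5 1 t) l).symm

theorem cubic_singular_along_quintic_rnc_swept_by_planes
    (F : MvPolynomial (Fin 6) ℂ) (hF0 : F ≠ 0) (hF : F.IsHomogeneous 3)
    (hsing : ∀ (s t : ℂ) (i : Fin 6), eval (nu5 s t) (pderiv i F) = 0) :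
    (∀ y : Fin 6 → ℂ, y ≠ 0 → eval y F = 0 →
      ∃ W : Submodule ℂ (Fin 6 → ℂ), Module.finrank ℂ W = 3 ∧ y ∈ W ∧
        ∀ w ∈ W, eval w F = 0) ∧
    ∃ W : Submodule ℂ (Fin 6 → ℂ), Module.finrank ℂ W = 3 ∧
      ∀ w ∈ W, eval w F = 0 := by
  obtain ⟨a, h⟩ := exists_six_mul_eval_eq_det_borderedHankel hF hsing
  have hiff (x : Fin 6 → ℂ) : eval x F = 0 ↔ (borderedHankel a x).det = 0 := by
    rw [← h]
    simp
  have ha : a ≠ 0 := by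
    rintro rfl
    refine hF0 (MvPolynomial.funext fun x => ?_)
    rw [map_zero, hiff]
    exact Matrix.det_eq_zero_of_row_eq_zero 3 fun k => by fin_cases k <;> rfl
  simp only [hiff]
  refine ⟨fun y _ hy => exists_finrank_three_of_det_borderedHankel_eq_zero ha hy, ?_⟩
  obtain ⟨W, hW, -, hWF⟩ := exists_finrank_three_of_det_borderedHankel_eq_zero ha (y := 0)
    (Matrix.det_eq_zero_of_row_eq_zero 0 fun k => by fin_cases k <;> rfl)
  exact ⟨W, hW, hWF⟩
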